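/- Let A, B be positive definite n×n complex matrices with α⁻¹B ≤ A ≤ αB for some α ≥ 1. Then for every n ∈ ℕ, the matrix Xₙ = ∫_{1/n}^{n} ((B+λ)⁻¹ − (A+λ)⁻¹) dλ satisfies ‖Xₙ‖ ≤ log α, and Xₙ converges to log A − log B as n → ∞. -/

import Mathlib

open Matrix
open scoped ComplexOrder

/-- The logarithm of a Hermitian matrix, defined via the spectral decomposition
(junk value `0` on non-Hermitian matrices). -/
noncomputable def matLog {n : ℕ} (A : Matrix (Fin n) (Fin n) ℂ) : Matrix (Fin n) (Fin n) ℂ :=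
  if h : A.IsHermitian then
    (h.eigenvectorUnitary : Matrix (Fin n) (Fin n) ℂ) *
      Matrix.diagonal (fun i => (Real.log (h.eigenvalues i) : ℂ)) *
      (star (h.eigenvectorUnitary : Matrix (Fin n) (Fin n) ℂ))
  else 0

open MeasureTheory

/-- Functional calculus of a Hermitian matrix, through its spectral decomposition. -/
noncomputable def Matrix.IsHermitian.spectralMap {n : ℕ} {P : Matrix (Fin n) (Fin n) ℂ}
    (hP : P.IsHermitian) (f : ℝ → ℝ) : Matrix (Fin n) (Fin n) ℂ :=
  (hP.eigenvectorUnitary : Matrix (Fin n) (Fin n) ℂ) *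
    Matrix.diagonal (fun i => (f (hP.eigenvalues i) : ℂ)) *
    (star (hP.eigenvectorUnitary : Matrix (Fin n) (Fin n) ℂ))

section SpectralMap

variable {n : ℕ} {P : Matrix (Fin n) (Fin n) ℂ}

theorem matLog_eq_spectralMap (hP : P.IsHermitian) : matLog P = hP.spectralMap Real.log := by
  simp [matLog, hP, Matrix.IsHermitian.spectralMap]

theorem Matrix.IsHermitian.spectralMap_apply (hP : P.IsHermitian) (f : ℝ → ℝ) (i j : Fin n) :
    hP.spectralMap f i j = ∑ m, (hP.eigenvectorUnitary : Matrix (Fin n) (Fin n) ℂ) i m *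
      (f (hP.eigenvalues m) : ℂ) *
      star ((hP.eigenvectorUnitary : Matrix (Fin n) (Fin n) ℂ) j m) := by
  rw [spectralMap, Matrix.mul_apply]
  simp only [Matrix.mul_diagonal, Matrix.star_apply]

theorem Matrix.IsHermitian.spectralMap_add (hP : P.IsHermitian) (f g : ℝ → ℝ) :
    hP.spectralMap (fun t => f t + g t) = hP.spectralMap f + hP.spectralMap g := by
  ext i j
  simp [spectralMap_apply, mul_add, add_mul, Finset.sum_add_distrib]

theorem Matrix.IsHermitian.spectralMap_sub (hP : P.IsHermitian) (f g : ℝ → ℝ) :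
    hP.spectralMap (fun t => f t - g t) = hP.spectralMap f - hP.spectralMap g := by
  ext i j
  simp [spectralMap_apply, mul_sub, sub_mul, Finset.sum_sub_distrib]

theorem Matrix.IsHermitian.spectralMap_mul (hP : P.IsHermitian) (f g : ℝ → ℝ) :
    hP.spectralMap (fun t => f t * g t) = hP.spectralMap f * hP.spectralMap g := by
  have h : star (hP.eigenvectorUnitary : Matrix (Fin n) (Fin n) ℂ) *
      (hP.eigenvectorUnitary : Matrix (Fin n) (Fin n) ℂ) = 1 :=
    Unitary.coe_star_mul_self hP.eigenvectorUnitary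
  simp only [spectralMap, Matrix.mul_assoc]
  rw [← Matrix.mul_assoc (star _) _ (_ * _), h, Matrix.one_mul,
    ← Matrix.mul_assoc (diagonal _) (diagonal _) _, Matrix.diagonal_mul_diagonal]
  simp

theorem Matrix.IsHermitian.spectralMap_const (hP : P.IsHermitian) (c : ℝ) :
    hP.spectralMap (fun _ => c) = (c : ℂ) • (1 : Matrix (Fin n) (Fin n) ℂ) := by
  have h : (hP.eigenvectorUnitary : Matrix (Fin n) (Fin n) ℂ) *
      star (hP.eigenvectorUnitary : Matrix (Fin n) (Fin n) ℂ) = 1 :=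
    Unitary.coe_mul_star_self hP.eigenvectorUnitary
  rw [spectralMap, ← Matrix.smul_one_eq_diagonal]
  simp [h]

theorem Matrix.IsHermitian.spectralMap_id (hP : P.IsHermitian) :
    hP.spectralMap (fun t => t) = P := by
  conv_rhs => rw [hP.spectral_theorem]
  rfl

theorem Matrix.IsHermitian.spectralMap_congr (hP : P.IsHermitian) {f g : ℝ → ℝ}
    (h : ∀ i, f (hP.eigenvalues i) = g (hP.eigenvalues i)) :
    hP.spectralMap f = hP.spectralMap g := by
  simp [spectralMap, h]

theorem Matrix.IsHermitian.posSemidef_spectralMap (hP : P.IsHermitian) {f : ℝ → ℝ}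
    (h : ∀ i, 0 ≤ f (hP.eigenvalues i)) : (hP.spectralMap f).PosSemidef := by
  have hd : (Matrix.diagonal fun i => (f (hP.eigenvalues i) : ℂ)).PosSemidef :=
    PosSemidef.diagonal fun i => by simpa using h i
  exact hd.mul_mul_conjTranspose_same _

theorem Matrix.IsHermitian.tendsto_spectralMap (hP : P.IsHermitian) {ι : Type*} {L : Filter ι}
    {f : ι → ℝ → ℝ} {g : ℝ → ℝ}
    (h : ∀ i, Filter.Tendsto (fun k => f k (hP.eigenvalues i)) L (nhds (g (hP.eigenvalues i)))) :
    Filter.Tendsto (fun k => hP.spectralMap (f k)) L (nhds (hP.spectralMap g)) := by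
  refine tendsto_pi_nhds.2 fun i => tendsto_pi_nhds.2 fun j => ?_
  simp only [spectralMap_apply]
  exact tendsto_finsetSum _ fun m _ => (((Complex.continuous_ofReal.tendsto _).comp
    (h m)).const_mul _).mul_const _

theorem Matrix.PosDef.smul_add_smul_one_inv (hP : P.PosDef) {c l : ℝ} (hc : 0 < c) (hl : 0 ≤ l) :
    ((c : ℂ) • P + (l : ℂ) • (1 : Matrix (Fin n) (Fin n) ℂ))⁻¹ =
      hP.1.spectralMap (fun t => (c * t + l)⁻¹) := by
  apply Matrix.inv_eq_right_inv
  have h : (c : ℂ) • P + (l : ℂ) • (1 : Matrix (Fin n) (Fin n) ℂ) =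
      hP.1.spectralMap (fun t => c * t + l) := by
    rw [hP.1.spectralMap_add, hP.1.spectralMap_mul, hP.1.spectralMap_const,
      hP.1.spectralMap_const, hP.1.spectralMap_id, Matrix.smul_mul, Matrix.one_mul]
  rw [h, ← hP.1.spectralMap_mul, hP.1.spectralMap_congr (g := fun _ => 1), hP.1.spectralMap_const]
  · simp
  · intro i
    have := hP.eigenvalues_pos i
    exact mul_inv_cancel₀ (by positivity)

theorem integrableOn_inv_add {a b t : ℝ} (ha : 0 < a) (ht : 0 < t) :
    IntegrableOn (fun l : ℝ => (t + l)⁻¹) (Set.Icc a b) := by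
  refine ContinuousOn.integrableOn_Icc (ContinuousOn.inv₀ (by fun_prop) fun l hl => ?_)
  linarith [hl.1]

theorem integral_Icc_inv_add {a b t : ℝ} (ha : 0 < a) (hab : a ≤ b) (ht : 0 < t) :
    ∫ l in Set.Icc a b, (t + l)⁻¹ = Real.log ((t + b) / (t + a)) := by
  rw [integral_Icc_eq_integral_Ioc, ← intervalIntegral.integral_of_le hab,
    intervalIntegral.integral_comp_add_left (fun x => x⁻¹) t,
    integral_inv_of_pos (by linarith) (by linarith)]

theorem Matrix.PosDef.integrableOn_resolvent (hP : P.PosDef) {c a b : ℝ} (hc : 0 < c) (ha : 0 < a)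
    (i j : Fin n) :
    IntegrableOn (fun l : ℝ => ((c : ℂ) • P + (l : ℂ) • (1 : Matrix (Fin n) (Fin n) ℂ))⁻¹ i j)
      (Set.Icc a b) := by
  have h : Set.EqOn (fun l : ℝ => hP.1.spectralMap (fun t => (c * t + l)⁻¹) i j)
      (fun l : ℝ => ((c : ℂ) • P + (l : ℂ) • (1 : Matrix (Fin n) (Fin n) ℂ))⁻¹ i j)
      (Set.Icc a b) := fun l hl => by
    simp only [hP.smul_add_smul_one_inv hc (ha.le.trans hl.1)]
  refine IntegrableOn.congr_fun ?_ h measurableSet_Icc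
  simp only [Matrix.IsHermitian.spectralMap_apply]
  exact integrable_finsetSum _ fun m _ => (((integrableOn_inv_add ha
    (mul_pos hc (hP.eigenvalues_pos m))).integrable.ofReal).const_mul _).mul_const _

theorem Matrix.PosDef.integral_resolvent (hP : P.PosDef) {c a b : ℝ} (hc : 0 < c) (ha : 0 < a)
    (hab : a ≤ b) (i j : Fin n) :
    ∫ l in Set.Icc a b, ((c : ℂ) • P + (l : ℂ) • (1 : Matrix (Fin n) (Fin n) ℂ))⁻¹ i j =
      hP.1.spectralMap (fun t => Real.log ((c * t + b) / (c * t + a))) i j := by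
  have h : Set.EqOn (fun l : ℝ => ((c : ℂ) • P + (l : ℂ) • (1 : Matrix (Fin n) (Fin n) ℂ))⁻¹ i j)
      (fun l : ℝ => hP.1.spectralMap (fun t => (c * t + l)⁻¹) i j)
      (Set.Icc a b) := fun l hl => by
    simp only [hP.smul_add_smul_one_inv hc (ha.le.trans hl.1)]
  rw [setIntegral_congr_fun measurableSet_Icc h]
  simp only [Matrix.IsHermitian.spectralMap_apply]
  rw [integral_finsetSum]
  · refine Finset.sum_congr rfl fun m _ => ?_
    rw [integral_mul_const, integral_const_mul, integral_complex_ofReal,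
      integral_Icc_inv_add ha hab (mul_pos hc (hP.eigenvalues_pos m))]
  · exact fun m _ => (((integrableOn_inv_add ha
      (mul_pos hc (hP.eigenvalues_pos m))).integrable.ofReal).const_mul _).mul_const _

end SpectralMap

theorem Matrix.PosDef.posSemidef_inv_sub_inv {n : ℕ} {P Q : Matrix (Fin n) (Fin n) ℂ}
    (hP : P.PosDef) (hQ : Q.PosDef) (h : (Q - P).PosSemidef) : (P⁻¹ - Q⁻¹).PosSemidef := by
  let _ := hQ.isUnit.invertible
  let _ := hP.inv.isUnit.invertible
  have h1 := (PosDef.fromBlocks₁₁ (1 : Matrix (Fin n) (Fin n) ℂ) P⁻¹ hQ)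
  have h2 := (PosDef.fromBlocks₂₂ Q (1 : Matrix (Fin n) (Fin n) ℂ) hP.inv)
  rw [h2] at h1
  simpa using h1.1 (by
    have : P⁻¹⁻¹ = P := Matrix.nonsing_inv_nonsing_inv _
      ((Matrix.isUnit_iff_isUnit_det _).1 hP.isUnit)
    simpa [this] using h)

theorem Matrix.posSemidef_of_integral {n : ℕ} {s : Set ℝ} (hs : MeasurableSet s)
    {F : ℝ → Matrix (Fin n) (Fin n) ℂ} {M : Matrix (Fin n) (Fin n) ℂ}
    (hF : ∀ l ∈ s, (F l).PosSemidef) (hint : ∀ i j, IntegrableOn (fun l => F l i j) s)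
    (hM : ∀ i j, M i j = ∫ l in s, F l i j) : M.PosSemidef := by
  refine PosSemidef.of_dotProduct_mulVec_nonneg ?_ fun x => ?_
  · ext i j
    rw [conjTranspose_apply, hM, hM, RCLike.star_def, ← integral_conj]
    exact setIntegral_congr_fun hs fun l hl => (hF l hl).1.apply i j
  · have h : star x ⬝ᵥ M *ᵥ x = ∫ l in s, star x ⬝ᵥ F l *ᵥ x := by
      simp only [dotProduct, mulVec, hM]
      rw [integral_finsetSum]
      · refine Finset.sum_congr rfl fun i _ => ?_
        rw [integral_const_mul, integral_finsetSum]
        · simp only [integral_mul_const]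
        · exact fun j _ => (hint i j).integrable.mul_const _
      · exact fun i _ => (integrable_finsetSum _ fun j _ =>
          (hint i j).integrable.mul_const _).const_mul _
    rw [h]
    exact integral_nonneg_of_ae ((ae_restrict_iff' hs).2 (.of_forall fun l hl =>
      (hF l hl).dotProduct_mulVec_nonneg x))

theorem Matrix.norm_toEuclideanCLM_le_of_posSemidef {n : ℕ} {M : Matrix (Fin n) (Fin n) ℂ} {r : ℝ}
    (h1 : ((r : ℂ) • (1 : Matrix (Fin n) (Fin n) ℂ) - M).PosSemidef)
    (h2 : ((r : ℂ) • (1 : Matrix (Fin n) (Fin n) ℂ) + M).PosSemidef) (hr : 0 ≤ r) :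
    ‖Matrix.toEuclideanCLM (𝕜 := ℂ) M‖ ≤ r := by
  have hM : M.IsHermitian := by
    have := h2.1.sub (isHermitian_one.smul (k := (r : ℂ)) (by simp [IsSelfAdjoint]))
    simpa using this
  have hsym :
      (Matrix.toEuclideanCLM (𝕜 := ℂ) M : EuclideanSpace ℂ (Fin n) →ₗ[ℂ] _).IsSymmetric := by
    rw [coe_toEuclideanCLM_eq_toEuclideanLin]
    exact isSymmetric_toEuclideanLin_iff.2 hM
  rw [ContinuousLinearMap.norm_eq_iSup_rayleighQuotient _ hsym]
  refine ciSup_le fun x => ?_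
  have e : ((Matrix.toEuclideanCLM (𝕜 := ℂ) M).reApplyInnerSelf x) =
      RCLike.re (star x.ofLp ⬝ᵥ M *ᵥ x.ofLp) := by
    rw [ContinuousLinearMap.reApplyInnerSelf_apply, ← inner_re_symm,
      EuclideanSpace.inner_eq_star_dotProduct, ofLp_toEuclideanCLM, dotProduct_comm]
  have e1 : RCLike.re (star x.ofLp ⬝ᵥ x.ofLp) = ‖x‖ ^ 2 := by
    rw [dotProduct_comm, ← EuclideanSpace.inner_eq_star_dotProduct, inner_self_eq_norm_sq]
  have p1 := h1.re_dotProduct_nonneg x.ofLp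
  have p2 := h2.re_dotProduct_nonneg x.ofLp
  simp only [sub_mulVec, add_mulVec, smul_mulVec, one_mulVec, dotProduct_sub, dotProduct_add,
    dotProduct_smul, map_sub, map_add] at p1 p2
  have e2 : RCLike.re ((r : ℂ) • (star x.ofLp ⬝ᵥ x.ofLp)) = r * ‖x‖ ^ 2 := by
    rw [← e1]; simp
  rw [e2, ← e] at p1 p2
  rw [ContinuousLinearMap.rayleighQuotient, abs_div, abs_of_nonneg (sq_nonneg ‖x‖)]
  refine div_le_of_le_mul₀ (sq_nonneg _) hr (abs_le.2 ⟨?_, ?_⟩) <;> linarith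

/-- One-sided bound on the truncated integral of the difference of resolvents. -/
theorem Matrix.PosDef.posSemidef_log_sub_spectralMap {n : ℕ} {P Q : Matrix (Fin n) (Fin n) ℂ}
    (hP : P.PosDef) (hQ : Q.PosDef) {α : ℝ} (hα : 1 ≤ α)
    (h : ((α : ℂ) • P - Q).PosSemidef) {a b : ℝ} (ha : 0 < a) (hab : a ≤ b) :
    ((Real.log α : ℂ) • (1 : Matrix (Fin n) (Fin n) ℂ) -
      (hP.1.spectralMap (fun t => Real.log ((t + b) / (t + a))) -
        hQ.1.spectralMap (fun t => Real.log ((t + b) / (t + a))))).PosSemidef := by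
  have hα0 : 0 < α := by linarith
  have hcomp : (hQ.1.spectralMap (fun t => Real.log ((1 * t + b) / (1 * t + a))) -
      hP.1.spectralMap (fun t => Real.log ((α * t + b) / (α * t + a)))).PosSemidef := by
    refine Matrix.posSemidef_of_integral (measurableSet_Icc (a := a) (b := b)) (F := fun l =>
      (((1 : ℝ) : ℂ) • Q + (l : ℂ) • (1 : Matrix (Fin n) (Fin n) ℂ))⁻¹ -
        ((α : ℂ) • P + (l : ℂ) • (1 : Matrix (Fin n) (Fin n) ℂ))⁻¹) ?_ ?_ ?_
    · intro l hl
      have hl0 : (0 : ℂ) < (l : ℂ) := by simpa using ha.trans_le hl.1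
      have hone := (PosDef.one (R := ℂ) (n := Fin n)).smul hl0
      refine PosDef.posSemidef_inv_sub_inv (by simpa using hQ.add hone)
        ((hP.smul (by simpa using hα0)).add hone) (by simpa using h)
    · exact fun i j => (hQ.integrableOn_resolvent one_pos ha i j).sub
        (hP.integrableOn_resolvent hα0 ha i j)
    · intro i j
      simp only [sub_apply]
      rw [integral_sub (hQ.integrableOn_resolvent one_pos ha i j)
        (hP.integrableOn_resolvent hα0 ha i j), hQ.integral_resolvent one_pos ha hab,
        hP.integral_resolvent hα0 ha hab]
  have hscal : (hP.1.spectralMap (fun t => Real.log α - Real.log ((t + b) / (t + a)) +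
      Real.log ((α * t + b) / (α * t + a)))).PosSemidef := by
    refine hP.1.posSemidef_spectralMap fun i => ?_
    have ht := hP.eigenvalues_pos i
    set t := hP.1.eigenvalues i
    have hb : 0 < b := ha.trans_le hab
    have hαt : t ≤ α * t := by nlinarith
    have h1 : 0 < t + a := by positivity
    have h2 : 0 < t + b := by positivity
    have h3 : 0 < α * t + a := by positivity
    have h4 : 0 < α * t + b := by positivity
    rw [Real.log_div h2.ne' h1.ne', Real.log_div h4.ne' h3.ne']
    have h5 : Real.log (t + b) ≤ Real.log (α * t + b) := Real.log_le_log h2 (by linarith)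
    have h6 : Real.log (α * t + a) ≤ Real.log α + Real.log (t + a) := by
      rw [← Real.log_mul hα0.ne' h1.ne']
      exact Real.log_le_log h3 (by nlinarith)
    linarith
  rw [hP.1.spectralMap_add, hP.1.spectralMap_sub, hP.1.spectralMap_const] at hscal
  convert hscal.add hcomp using 1
  simp only [one_mul]
  abel

/-- If `A, B` are positive definite with `α⁻¹ B ≤ A ≤ α B` for some `α ≥ 1`, then the
matrices `Xₖ = ∫_{1/k}^{k} ((B+λ)⁻¹ − (A+λ)⁻¹) dλ` (defined entrywise) satisfy
`‖Xₖ‖ ≤ log α` in operator norm, and `Xₖ → log A − log B` as `k → ∞`. -/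
theorem truncated_integral_resolvent_bounded_and_tendsto_matLog {n : ℕ}
    (A B : Matrix (Fin n) (Fin n) ℂ) (hA : A.PosDef) (hB : B.PosDef)
    (α : ℝ) (hα : 1 ≤ α)
    (h1 : (A - (α⁻¹ : ℂ) • B).PosSemidef) (h2 : ((α : ℂ) • B - A).PosSemidef)
    (X : ℕ → Matrix (Fin n) (Fin n) ℂ)
    (hX : ∀ k : ℕ, 1 ≤ k → ∀ i j, X k i j =
      ∫ l in Set.Icc ((k : ℝ)⁻¹) (k : ℝ),
        (((B + (l : ℂ) • (1 : Matrix (Fin n) (Fin n) ℂ))⁻¹ -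
          (A + (l : ℂ) • (1 : Matrix (Fin n) (Fin n) ℂ))⁻¹) i j)) :
    (∀ k : ℕ, 1 ≤ k → ‖Matrix.toEuclideanCLM (𝕜 := ℂ) (X k)‖ ≤ Real.log α) ∧
    Filter.Tendsto X Filter.atTop (nhds (matLog A - matLog B)) := by
  have hα0 : 0 < α := by linarith
  have hk : ∀ k : ℕ, 1 ≤ k → 0 < (k : ℝ)⁻¹ ∧ (k : ℝ)⁻¹ ≤ k := fun k hk => by
    have : (1 : ℝ) ≤ k := by exact_mod_cast hk
    exact ⟨by positivity, (inv_le_one_of_one_le₀ this).trans this⟩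
  have hXeq : ∀ k : ℕ, 1 ≤ k → X k =
      hB.1.spectralMap (fun t => Real.log ((t + k) / (t + (k : ℝ)⁻¹))) -
        hA.1.spectralMap (fun t => Real.log ((t + k) / (t + (k : ℝ)⁻¹))) := by
    intro k hk1
    obtain ⟨ha, hab⟩ := hk k hk1
    ext i j
    have iA := hA.integrableOn_resolvent (b := k) one_pos ha i j
    have iB := hB.integrableOn_resolvent (b := k) one_pos ha i j
    have eA := hA.integral_resolvent one_pos ha hab i j
    have eB := hB.integral_resolvent one_pos ha hab i j
    simp only [Complex.ofReal_one, one_smul, one_mul] at iA iB eA eB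
    rw [hX k hk1, Matrix.sub_apply, ← eA, ← eB, ← integral_sub iB iA]
    rfl
  refine ⟨fun k hk1 => ?_, ?_⟩
  · obtain ⟨ha, hab⟩ := hk k hk1
    have h1' : ((α : ℂ) • A - B).PosSemidef := by
      have hα' : (0 : ℂ) ≤ (α : ℂ) := by simpa using hα0.le
      have := h1.smul hα'
      rwa [smul_sub, smul_smul, mul_inv_cancel₀ (by exact_mod_cast hα0.ne'), one_smul] at this
    rw [hXeq k hk1]
    refine Matrix.norm_toEuclideanCLM_le_of_posSemidef
      (hB.posSemidef_log_sub_spectralMap hA hα h2 ha hab) ?_ (Real.log_nonneg hα)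
    convert hA.posSemidef_log_sub_spectralMap hB hα h1' ha hab using 1
    abel
  · have hlim : ∀ t : ℝ, 0 < t → Filter.Tendsto
        (fun k : ℕ => Real.log ((t + k) / (t + (k : ℝ)⁻¹)) - Real.log k) Filter.atTop
        (nhds (0 - Real.log t)) := by
      intro t ht
      have hinv : Filter.Tendsto (fun k : ℕ => (k : ℝ)⁻¹) Filter.atTop (nhds 0) :=
        tendsto_inv_atTop_nhds_zero_nat
      have l1 : Filter.Tendsto (fun k : ℕ => Real.log (t * (k : ℝ)⁻¹ + 1)) Filter.atTop
          (nhds 0) := by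
        simpa using ((hinv.const_mul t).add_const 1).log (by simp)
      have l2 : Filter.Tendsto (fun k : ℕ => Real.log (t + (k : ℝ)⁻¹)) Filter.atTop
          (nhds (Real.log t)) := by
        simpa using (hinv.const_add t).log (by simpa using ht.ne')
      refine (l1.sub l2).congr' ?_
      filter_upwards [Filter.eventually_ge_atTop 1] with k hk1
      have hk0 : (0 : ℝ) < k := by exact_mod_cast hk1
      rw [Real.log_div (by positivity) (by positivity),
        show t + (k : ℝ) = (t * (k : ℝ)⁻¹ + 1) * k by field_simp,
        Real.log_mul (by positivity) hk0.ne']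
      ring
    have hS : ∀ {P : Matrix (Fin n) (Fin n) ℂ} (hP : P.PosDef), Filter.Tendsto
        (fun k : ℕ => hP.1.spectralMap
          (fun t => Real.log ((t + k) / (t + (k : ℝ)⁻¹)) - Real.log k)) Filter.atTop
        (nhds (-matLog P)) := by
      intro P hP
      have e : -matLog P = hP.1.spectralMap (fun t => 0 - Real.log t) := by
        rw [hP.1.spectralMap_sub, hP.1.spectralMap_const, matLog_eq_spectralMap hP.1]
        simp
      rw [e]
      exact hP.1.tendsto_spectralMap fun i => hlim _ (hP.eigenvalues_pos i)
    have hlimX := (hS hB).sub (hS hA)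
    rw [show -matLog B - -matLog A = matLog A - matLog B by abel] at hlimX
    refine hlimX.congr' ?_
    filter_upwards [Filter.eventually_ge_atTop 1] with k hk1
    rw [hXeq k hk1, hB.1.spectralMap_sub, hA.1.spectralMap_sub, hB.1.spectralMap_const,
      hA.1.spectralMap_const]
    abel
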